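/- arXiv:2506.12246 — 9 statements merged into one kernel-verified Lean document; each statement's English description precedes it below -/
import Mathlib

section
/- Let A, B ⊆ ℕ and let n ∈ ℕ be such that for every z ≥ n one has z ∈ A if and only if n ∈ A. Then for every z ≥ n one has z ∈ A / B if and only if n ∈ A / B, where A / B is the element-wise division without remainder. -/
/-- Element-wise division without remainder on subsets of ℕ. -/
def setDiv (A B : Set ℕ) : Set ℕ := {c | ∃ a ∈ A, ∃ b ∈ B, b ≠ 0 ∧ a = c * b}

theorem division_preserves_threshold (A B : Set ℕ) (n : ℕ)
    (hA : ∀ z ≥ n, (z ∈ A ↔ n ∈ A)) :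
    ∀ z ≥ n, (z ∈ setDiv A B ↔ n ∈ setDiv A B) := by
  have mem_of_mem : ∀ x ≥ n, ∀ y ≥ n, x ∈ setDiv A B → y ∈ setDiv A B := by
    rintro x hx y hy ⟨_, ha, b, hb, hb0, rfl⟩
    have le_mul {c : ℕ} (hc : n ≤ c) : n ≤ c * b :=
      hc.trans (Nat.le_mul_of_pos_right c (Nat.pos_of_ne_zero hb0))
    exact ⟨y * b, (hA _ (le_mul hy)).2 ((hA _ (le_mul hx)).1 ha), b, hb, hb0, rfl⟩
  exact fun z hz => ⟨mem_of_mem z hz n le_rfl, mem_of_mem n le_rfl z hz⟩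
end

section
/- Let 𝒞 be the smallest collection of subsets of ℕ that contains the singleton {a} for every a ∈ ℕ and is closed under binary union, binary intersection, complement in ℕ, element-wise addition, and element-wise division without remainder. Then for every S ∈ 𝒞 there exists n ∈ ℕ such that for all z ≥ n, z ∈ S if and only if n ∈ S. -/
/-- Element-wise addition on subsets of ℕ. -/
def setAdd (A B : Set ℕ) : Set ℕ := {c | ∃ a ∈ A, ∃ b ∈ B, c = a + b}

/-- The smallest collection of subsets of ℕ containing all singletons and closed under
union, intersection, complement, element-wise addition and element-wise division
without remainder (result sets of {∪, ∩, ‾, +, /}-circuits). -/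
inductive CircSet : Set ℕ → Prop
  | single (a : ℕ) : CircSet {a}
  | union {A B : Set ℕ} : CircSet A → CircSet B → CircSet (A ∪ B)
  | inter {A B : Set ℕ} : CircSet A → CircSet B → CircSet (A ∩ B)
  | compl {A : Set ℕ} : CircSet A → CircSet Aᶜ
  | add {A B : Set ℕ} : CircSet A → CircSet B → CircSet (setAdd A B)
  | div {A B : Set ℕ} : CircSet A → CircSet B → CircSet (setDiv A B)

/-- Every set in the collection is cofinite or finite, expressed by an explicit bound. -/
theorem CircSet.exists_forall_mem_or_forall_notMem {S : Set ℕ} (hS : CircSet S) :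
    ∃ n : ℕ, (∀ z ≥ n, z ∈ S) ∨ ∀ z ≥ n, z ∉ S := by
  induction hS with
  | single a =>
    refine ⟨a + 1, Or.inr fun z hz h => ?_⟩
    rw [Set.mem_singleton_iff] at h
    omega
  | union _ _ ihA ihB =>
    obtain ⟨n, hA⟩ := ihA
    obtain ⟨m, hB⟩ := ihB
    refine ⟨n + m, ?_⟩
    rcases hA with hA | hA
    · exact Or.inl fun z hz => Or.inl (hA z (by omega))
    rcases hB with hB | hB
    · exact Or.inl fun z hz => Or.inr (hB z (by omega))
    · exact Or.inr fun z hz h => h.elim (hA z (by omega)) (hB z (by omega))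
  | inter _ _ ihA ihB =>
    obtain ⟨n, hA⟩ := ihA
    obtain ⟨m, hB⟩ := ihB
    refine ⟨n + m, ?_⟩
    rcases hA with hA | hA
    · rcases hB with hB | hB
      · exact Or.inl fun z hz => ⟨hA z (by omega), hB z (by omega)⟩
      · exact Or.inr fun z hz h => hB z (by omega) h.2
    · exact Or.inr fun z hz h => hA z (by omega) h.1
  | compl _ ihA =>
    obtain ⟨n, hA | hA⟩ := ihA
    · exact ⟨n, Or.inr fun z hz h => h (hA z hz)⟩
    · exact ⟨n, Or.inl hA⟩
  | @add A B _ _ ihA ihB =>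
    obtain ⟨n, hA⟩ := ihA
    obtain ⟨m, hB⟩ := ihB
    by_cases hne : A.Nonempty ∧ B.Nonempty
    · obtain ⟨⟨a, ha⟩, b, hb⟩ := hne
      rcases hA with hA | hA
      · exact ⟨n + b, Or.inl fun z hz => ⟨z - b, hA _ (by omega), b, hb, by omega⟩⟩
      rcases hB with hB | hB
      · exact ⟨m + a, Or.inl fun z hz => ⟨a, ha, z - a, hB _ (by omega), by omega⟩⟩
      · refine ⟨n + m, Or.inr ?_⟩
        rintro z hz ⟨x, hx, y, hy, rfl⟩
        have hxn : x < n := not_le.1 fun h => hA x h hx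
        have hym : y < m := not_le.1 fun h => hB y h hy
        omega
    · refine ⟨0, Or.inr ?_⟩
      rintro z - ⟨x, hx, y, hy, -⟩
      exact hne ⟨⟨x, hx⟩, y, hy⟩
  | @div A B _ _ ihA _ =>
    obtain ⟨n, hA | hA⟩ := ihA
    · by_cases hB : ∃ b ∈ B, b ≠ 0
      · obtain ⟨b, hb, hb0⟩ := hB
        exact ⟨n, Or.inl fun z hz =>
          ⟨z * b, hA _ (le_trans hz (Nat.le_mul_of_pos_right z (Nat.pos_of_ne_zero hb0))),
            b, hb, hb0, rfl⟩⟩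
      · refine ⟨0, Or.inr ?_⟩
        rintro z - ⟨_, -, b, hb, hb0, -⟩
        exact hB ⟨b, hb, hb0⟩
    · refine ⟨n, Or.inr ?_⟩
      rintro z hz ⟨_, ha, b, -, hb0, rfl⟩
      exact hA _ (le_trans hz (Nat.le_mul_of_pos_right z (Nat.pos_of_ne_zero hb0))) ha

theorem circSet_has_threshold (S : Set ℕ) (hS : CircSet S) :
    ∃ n : ℕ, ∀ z ≥ n, (z ∈ S ↔ n ∈ S) := by
  obtain ⟨n, h | h⟩ := hS.exists_forall_mem_or_forall_notMem
  · exact ⟨n, fun z hz => iff_of_true (h z hz) (h n le_rfl)⟩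
  · exact ⟨n, fun z hz => iff_of_false (h z hz) (h n le_rfl)⟩
end

section
/- Let A ⊆ ℕ be such that both A and its complement ℕ \ A are infinite. Then A does not belong to the smallest collection 𝒞 of subsets of ℕ that contains the singleton {a} for every a ∈ ℕ and is closed under binary union, binary intersection, complement in ℕ, element-wise addition, and element-wise division without remainder. Equivalently, no {∪, ∩, complement, +, /}-circuit computes A. -/
/-- A set of natural numbers with finite complement contains all sufficiently large numbers. -/
theorem exists_forall_ge_mem_of_finite_compl {A : Set ℕ} (hA : Aᶜ.Finite) :
    ∃ N, ∀ n, N ≤ n → n ∈ A := by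
  obtain ⟨N, hN⟩ := hA.bddAbove
  refine ⟨N + 1, fun n hn => ?_⟩
  by_contra h
  have := hN h
  omega

theorem finite_compl_of_forall_ge_mem {A : Set ℕ} {N : ℕ} (h : ∀ n, N ≤ n → n ∈ A) :
    Aᶜ.Finite :=
  (Set.finite_lt_nat N).subset fun n hn => not_le.mp fun hle => hn (h n hle)

theorem setAdd_comm (A B : Set ℕ) : setAdd A B = setAdd B A := by
  ext c
  constructor <;> rintro ⟨a, ha, b, hb, rfl⟩ <;> exact ⟨b, hb, a, ha, add_comm _ _⟩

theorem setAdd_finite {A B : Set ℕ} (hA : A.Finite) (hB : B.Finite) : (setAdd A B).Finite := by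
  refine (hA.image2 (· + ·) hB).subset ?_
  rintro _ ⟨a, ha, b, hb, rfl⟩
  exact ⟨a, ha, b, hb, rfl⟩

theorem setAdd_finite_or_compl_finite_of_compl_finite {A : Set ℕ} (hA : Aᶜ.Finite) (B : Set ℕ) :
    (setAdd A B).Finite ∨ (setAdd A B)ᶜ.Finite := by
  obtain ⟨N, hN⟩ := exists_forall_ge_mem_of_finite_compl hA
  by_cases hB : ∃ b, b ∈ B
  · obtain ⟨b, hb⟩ := hB
    refine .inr (finite_compl_of_forall_ge_mem (N := N + b) fun n hn => ?_)
    exact ⟨n - b, hN _ (by omega), b, hb, by omega⟩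
  · refine .inl (Set.finite_empty.subset ?_)
    rintro _ ⟨_, _, b, hb, _⟩
    exact hB ⟨b, hb⟩

theorem setDiv_finite {A : Set ℕ} (hA : A.Finite) (B : Set ℕ) : (setDiv A B).Finite := by
  obtain ⟨M, hM⟩ := hA.bddAbove
  refine (Set.finite_le_nat M).subset ?_
  rintro c ⟨_, ha, b, -, hb, rfl⟩
  exact (Nat.le_mul_of_pos_right c (Nat.pos_of_ne_zero hb)).trans (hM ha)

theorem setDiv_finite_or_compl_finite_of_compl_finite {A : Set ℕ} (hA : Aᶜ.Finite) (B : Set ℕ) :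
    (setDiv A B).Finite ∨ (setDiv A B)ᶜ.Finite := by
  obtain ⟨N, hN⟩ := exists_forall_ge_mem_of_finite_compl hA
  by_cases hB : ∃ b ∈ B, b ≠ 0
  · obtain ⟨b, hb, hb0⟩ := hB
    refine .inr (finite_compl_of_forall_ge_mem (N := N) fun n hn => ?_)
    have hle := hn.trans (Nat.le_mul_of_pos_right n (Nat.pos_of_ne_zero hb0))
    exact ⟨n * b, hN _ hle, b, hb, hb0, rfl⟩
  · refine .inl (Set.finite_empty.subset ?_)
    rintro _ ⟨_, _, b, hb, hb0, _⟩
    exact hB ⟨b, hb, hb0⟩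

/-- Every set computed by a circuit is finite or cofinite. -/
theorem CircSet.finite_or_compl_finite {A : Set ℕ} (h : CircSet A) : A.Finite ∨ Aᶜ.Finite := by
  induction h with
  | single a => exact .inl (Set.finite_singleton a)
  | union _ _ ihA ihB =>
    rw [Set.compl_union]
    rcases ihA with hA | hA
    · rcases ihB with hB | hB
      · exact .inl (hA.union hB)
      · exact .inr (hB.subset Set.inter_subset_right)
    · exact .inr (hA.subset Set.inter_subset_left)
  | inter _ _ ihA ihB =>
    rw [Set.compl_inter]
    rcases ihA with hA | hA
    · exact .inl (hA.subset Set.inter_subset_left)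
    · rcases ihB with hB | hB
      · exact .inl (hB.subset Set.inter_subset_right)
      · exact .inr (hA.union hB)
  | compl _ ih =>
    rw [compl_compl]
    exact ih.symm
  | @add A B _ _ ihA ihB =>
    rcases ihA with hA | hA
    · rcases ihB with hB | hB
      · exact .inl (setAdd_finite hA hB)
      · rw [setAdd_comm]
        exact setAdd_finite_or_compl_finite_of_compl_finite hB A
    · exact setAdd_finite_or_compl_finite_of_compl_finite hA B
  | @div A B _ _ ihA _ =>
    rcases ihA with hA | hA
    · exact .inl (setDiv_finite hA B)
    · exact setDiv_finite_or_compl_finite_of_compl_finite hA B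

theorem infinite_coinfinite_not_circSet (A : Set ℕ)
    (hA : A.Infinite) (hAc : Aᶜ.Infinite) : ¬ CircSet A := by
  intro h
  rcases h.finite_or_compl_finite with hfin | hfin
  · exact hA hfin
  · exact hAc hfin
end

section
/- Let ℰ be the smallest collection of subsets of ℕ that contains the singleton {a} for every a ∈ ℕ and is closed under binary intersection, element-wise addition, element-wise multiplication, and element-wise division without remainder. Then every member of ℰ has at most one element. -/
/-- Element-wise multiplication on subsets of ℕ. -/
def setMul (A B : Set ℕ) : Set ℕ := {c | ∃ a ∈ A, ∃ b ∈ B, c = a * b}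

/-- The smallest collection of subsets of ℕ containing all singletons and closed under
intersection, element-wise addition, multiplication and division without remainder
(result sets of {∩, +, ×, /}-circuits). -/
inductive InterCircSet : Set ℕ → Prop
  | single (a : ℕ) : InterCircSet {a}
  | inter {A B : Set ℕ} : InterCircSet A → InterCircSet B → InterCircSet (A ∩ B)
  | add {A B : Set ℕ} : InterCircSet A → InterCircSet B → InterCircSet (setAdd A B)
  | mul {A B : Set ℕ} : InterCircSet A → InterCircSet B → InterCircSet (setMul A B)
  | div {A B : Set ℕ} : InterCircSet A → InterCircSet B → InterCircSet (setDiv A B)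

theorem interCircSet_subsingleton (S : Set ℕ) (hS : InterCircSet S) : S.Subsingleton := by
  induction hS with
  | single a => exact Set.subsingleton_singleton
  | inter _ _ hA _ => exact hA.anti Set.inter_subset_left
  | add _ _ hA hB =>
    rintro _ ⟨a, ha, b, hb, rfl⟩ _ ⟨a', ha', b', hb', rfl⟩
    rw [hA ha ha', hB hb hb']
  | mul _ _ hA hB =>
    rintro _ ⟨a, ha, b, hb, rfl⟩ _ ⟨a', ha', b', hb', rfl⟩
    rw [hA ha ha', hB hb hb']
  | div _ _ hA hB =>
    rintro c ⟨a, ha, b, hb, hb0, hc⟩ d ⟨a', ha', b', hb', -, hd⟩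
    rw [← hA ha ha', ← hB hb hb'] at hd
    exact mul_right_cancel₀ hb0 (hc.symm.trans hd)
end

section
/- Let A, B ⊆ ℕ each have at most one element. Then A ∩ B = A × ({1} / ((A + {1}) / (B + {1}))), where +, ×, / are the element-wise operations on subsets of ℕ and / is division without remainder. -/
theorem inter_eq_mul_div_gadget (A B : Set ℕ)
    (hA : A.Subsingleton) (hB : B.Subsingleton) :
    A ∩ B = setMul A (setDiv {1} (setDiv (setAdd A {1}) (setAdd B {1}))) := by
  ext c
  constructor
  · rintro ⟨hcA, hcB⟩
    exact ⟨c, hcA, 1, ⟨1, rfl, 1, ⟨c + 1, ⟨c, hcA, 1, rfl, rfl⟩, c + 1, ⟨c, hcB, 1, rfl, rfl⟩,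
      c.succ_ne_zero, (one_mul _).symm⟩, one_ne_zero, rfl⟩, (mul_one c).symm⟩
  · rintro ⟨a, ha, k, ⟨_, rfl, y, ⟨_, ⟨a', ha', _, rfl, rfl⟩, _, ⟨b, hb, _, rfl, rfl⟩, -, hab⟩,
      -, hky⟩, rfl⟩
    obtain ⟨rfl, rfl⟩ := mul_eq_one.mp hky.symm
    obtain rfl := hA ha ha'
    obtain rfl : a = b := by simpa using hab
    rw [mul_one]
    exact ⟨ha, hb⟩
end

section
/- Let α be a type with decidable equality, X a finite subset of α (a Finset), k ∈ ℕ, and A : Fin k → Finset α with A j nonempty and A j ⊆ X for every j. Let p : α → ℕ be injective with p x prime for all x, and set f(S) = ∏_{x ∈ S} p x for Finsets S. Define T : ℕ → Set ℕ by T 0 = {f(X)} and T (i+1) = T i ∪ (T i / {f(A i)}), where / is element-wise division without remainder. Then T k = { f(X \ ⋃_{j ∈ I} A j) | I a subset of Fin k such that the sets A j, j ∈ I, are pairwise disjoint }. -/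
theorem subset_of_prod_dvd_prod {α : Type*} {p : α → ℕ} (hinj : Function.Injective p)
    (hprime : ∀ x, (p x).Prime) {S R : Finset α} (h : ∏ x ∈ S, p x ∣ ∏ x ∈ R, p x) :
    S ⊆ R := by
  intro x hx
  obtain ⟨y, hy, hxy⟩ := ((hprime x).prime.dvd_finsetProd_iff p).1
    ((Finset.dvd_prod_of_mem p hx).trans h)
  rwa [hinj ((Nat.prime_dvd_prime_iff_eq (hprime x) (hprime y)).1 hxy)]

theorem prod_eq_mul_prod_iff {α : Type*} [DecidableEq α] {p : α → ℕ}
    (hinj : Function.Injective p) (hprime : ∀ x, (p x).Prime) {S R : Finset α} {c : ℕ} :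
    ∏ x ∈ R, p x = c * ∏ x ∈ S, p x ↔ S ⊆ R ∧ c = ∏ x ∈ R \ S, p x := by
  constructor
  · intro h
    have hSR : S ⊆ R := subset_of_prod_dvd_prod hinj hprime (h ▸ dvd_mul_left _ _)
    refine ⟨hSR, ?_⟩
    rw [← Finset.prod_sdiff hSR] at h
    exact (Nat.eq_of_mul_eq_mul_right (Finset.prod_pos fun x _ => (hprime x).pos) h).symm
  · rintro ⟨hSR, rfl⟩
    exact (Finset.prod_sdiff hSR).symm

theorem circuit_invariant_of_le {α : Type*} [DecidableEq α]
    (X : Finset α) (k : ℕ) (A : Fin k → Finset α) (hsub : ∀ j, A j ⊆ X)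
    (p : α → ℕ) (hinj : Function.Injective p) (hprime : ∀ x, (p x).Prime)
    (T : ℕ → Set ℕ) (hT0 : T 0 = {∏ x ∈ X, p x})
    (hTs : ∀ i : Fin k, T (i + 1) = T i ∪ setDiv (T i) {∏ x ∈ A i, p x})
    (n : ℕ) (hn : n ≤ k) (m : ℕ) :
    m ∈ T n ↔ ∃ I : Finset (Fin k), (∀ i ∈ I, (i : ℕ) < n) ∧
      (∀ i ∈ I, ∀ j ∈ I, i ≠ j → Disjoint (A i) (A j)) ∧
      m = ∏ x ∈ X \ I.biUnion A, p x := by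
  induction n generalizing m with
  | zero =>
    rw [hT0, Set.mem_singleton_iff]
    constructor
    · rintro rfl
      exact ⟨∅, by simp⟩
    · rintro ⟨I, hI, -, rfl⟩
      have : I = ∅ := Finset.eq_empty_of_forall_notMem fun i hi => absurd (hI i hi) (by simp)
      simp [this]
  | succ n ih =>
    have ih := ih (by omega)
    have hstep := hTs ⟨n, hn⟩
    set a : Fin k := ⟨n, hn⟩ with ha
    have han : (a : ℕ) = n := rfl
    rw [han] at hstep
    rw [hstep, Set.mem_union]
    constructor
    · rintro (h | ⟨q, hq, b, rfl, -, hqm⟩)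
      · obtain ⟨I, hI, hd, hm⟩ := (ih m).1 h
        exact ⟨I, fun i hi => (hI i hi).trans n.lt_succ_self, hd, hm⟩
      · obtain ⟨I, hI, hd, rfl⟩ := (ih q).1 hq
        obtain ⟨hs, rfl⟩ := (prod_eq_mul_prod_iff hinj hprime).1 hqm
        have hda : ∀ j ∈ I, Disjoint (A a) (A j) := fun j hj =>
          Finset.disjoint_left.2 fun x hx hxj =>
            (Finset.mem_sdiff.1 (hs hx)).2 (Finset.mem_biUnion.2 ⟨j, hj, hxj⟩)
        refine ⟨insert a I, ?_, ?_, ?_⟩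
        · intro i hi
          rcases Finset.mem_insert.1 hi with rfl | hi
          · omega
          · exact (hI i hi).trans n.lt_succ_self
        · intro i hi j hj hij
          rcases Finset.mem_insert.1 hi with rfl | hi <;>
            rcases Finset.mem_insert.1 hj with rfl | hj
          · exact absurd rfl hij
          · exact hda j hj
          · exact (hda i hi).symm
          · exact hd i hi j hj hij
        · rw [Finset.biUnion_insert, Finset.union_comm, sdiff_sdiff_left, Finset.sup_eq_union]
    · rintro ⟨I, hI, hd, rfl⟩
      by_cases haI : a ∈ I
      · right
        refine ⟨∏ x ∈ X \ (I.erase a).biUnion A, p x, (ih _).2 ⟨I.erase a, ?_, ?_, rfl⟩,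
          _, rfl, (Finset.prod_pos fun x _ => (hprime x).pos).ne', ?_⟩
        · intro i hi
          obtain ⟨hne, hi⟩ := Finset.mem_erase.1 hi
          have := hI i hi
          have : (i : ℕ) ≠ n := fun h => hne (Fin.ext h)
          omega
        · exact fun i hi j hj => hd i (Finset.mem_of_mem_erase hi) j (Finset.mem_of_mem_erase hj)
        · refine (prod_eq_mul_prod_iff hinj hprime).2 ⟨fun x hx => ?_, ?_⟩
          · refine Finset.mem_sdiff.2 ⟨hsub a hx, fun h => ?_⟩
            obtain ⟨j, hj, hxj⟩ := Finset.mem_biUnion.1 h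
            obtain ⟨hne, hj⟩ := Finset.mem_erase.1 hj
            exact Finset.disjoint_left.1 (hd j hj a haI hne) hxj hx
          · rw [sdiff_sdiff_left, Finset.sup_eq_union, Finset.union_comm,
              ← Finset.biUnion_insert, Finset.insert_erase haI]
      · left
        refine (ih _).2 ⟨I, fun i hi => ?_, hd, rfl⟩
        have := hI i hi
        have : (i : ℕ) ≠ n := fun h => haI (by rwa [← show i = a from Fin.ext h])
        omega

theorem exactCover_circuit_invariant {α : Type*} [DecidableEq α]
    (X : Finset α) (k : ℕ) (A : Fin k → Finset α)
    (hnonempty : ∀ j, (A j).Nonempty) (hsub : ∀ j, A j ⊆ X)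
    (p : α → ℕ) (hinj : Function.Injective p) (hprime : ∀ x, (p x).Prime)
    (f : Finset α → ℕ) (hf : ∀ S, f S = ∏ x ∈ S, p x)
    (T : ℕ → Set ℕ) (hT0 : T 0 = {f X})
    (hTs : ∀ i : Fin k, T (i + 1) = T i ∪ setDiv (T i) {f (A i)}) :
    T k = { m | ∃ I : Finset (Fin k),
      (∀ i ∈ I, ∀ j ∈ I, i ≠ j → Disjoint (A i) (A j)) ∧
      m = f (X \ I.biUnion A) } := by
  simp only [hf] at hT0 hTs ⊢
  ext m
  rw [circuit_invariant_of_le X k A hsub p hinj hprime T hT0 hTs k le_rfl m]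
  simp
end

section
/- Let α be a type with decidable equality, X a finite subset of α (a Finset), k ∈ ℕ, and A : Fin k → Finset α with A j nonempty and A j ⊆ X for every j. Let p : α → ℕ be injective with p x prime for all x, and set f(S) = ∏_{x ∈ S} p x. Define T : ℕ → Set ℕ by T 0 = {f(X)} and T (i+1) = T i ∪ (T i / {f(A i)}), where / is element-wise division without remainder. Then 1 ∈ T k if and only if there exists a subset I of Fin k such that the sets A j, j ∈ I, are pairwise disjoint and ⋃_{j ∈ I} A j = X (i.e., the family (A j)_{j ∈ I} is an exact cover of X). -/
/-- Iterated division by `d 0, …, d (n - 1)` yields the cofactors in `m` of subproducts of `d`. -/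
theorem mem_iterate_setDiv_iff {k : ℕ} (d : Fin k → ℕ) (hd : ∀ i, d i ≠ 0) (m : ℕ)
    (T : ℕ → Set ℕ) (hT0 : T 0 = {m})
    (hTs : ∀ i : Fin k, T (i + 1) = T i ∪ setDiv (T i) {d i}) (n : ℕ) (hn : n ≤ k) (c : ℕ) :
    c ∈ T n ↔ ∃ I : Finset (Fin k), (∀ i ∈ I, (i : ℕ) < n) ∧ c * ∏ i ∈ I, d i = m := by
  induction n generalizing c with
  | zero =>
    rw [hT0, Set.mem_singleton_iff]
    constructor
    · rintro rfl
      exact ⟨∅, by simp, by simp⟩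
    · rintro ⟨I, hI, h⟩
      obtain rfl : I = ∅ :=
        Finset.eq_empty_of_forall_notMem fun i hi => Nat.not_lt_zero _ (hI i hi)
      simpa using h
  | succ n ih =>
    have step : T (n + 1) = T n ∪ setDiv (T n) {d ⟨n, hn⟩} := hTs ⟨n, hn⟩
    have hdiv : c ∈ setDiv (T n) {d ⟨n, hn⟩} ↔ c * d ⟨n, hn⟩ ∈ T n := by
      simp [setDiv, hd]
    rw [step, Set.mem_union, hdiv, ih (by omega), ih (by omega)]
    constructor
    · rintro (⟨I, hI, h⟩ | ⟨I, hI, h⟩)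
      · exact ⟨I, fun i hi => (hI i hi).trans n.lt_succ_self, h⟩
      · have hnot : (⟨n, hn⟩ : Fin k) ∉ I := fun hi => (hI _ hi).false
        refine ⟨insert ⟨n, hn⟩ I, fun i hi => ?_, ?_⟩
        · rcases Finset.mem_insert.mp hi with rfl | hi
          · exact n.lt_succ_self
          · exact (hI i hi).trans n.lt_succ_self
        · rw [Finset.prod_insert hnot, ← mul_assoc, h]
    · rintro ⟨I, hI, h⟩
      have hlt : ∀ i ∈ I, i ≠ ⟨n, hn⟩ → (i : ℕ) < n := fun i hi hne =>
        lt_of_le_of_ne (Nat.lt_succ_iff.mp (hI i hi)) fun e => hne (Fin.ext e)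
      by_cases hmem : (⟨n, hn⟩ : Fin k) ∈ I
      · refine Or.inr ⟨I.erase ⟨n, hn⟩, fun i hi => ?_, ?_⟩
        · exact hlt i (Finset.mem_of_mem_erase hi) (Finset.ne_of_mem_erase hi)
        · rw [mul_assoc, Finset.mul_prod_erase I d hmem, h]
      · exact Or.inl ⟨I, fun i hi => hlt i hi fun e => hmem (e ▸ hi), h⟩

theorem prime_dvd_prod_iff_mem {α : Type*} {p : α → ℕ} (hinj : Function.Injective p)
    (hprime : ∀ x, (p x).Prime) (S : Finset α) (x : α) : p x ∣ ∏ y ∈ S, p y ↔ x ∈ S := by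
  rw [(hprime x).prime.dvd_finsetProd_iff]
  constructor
  · rintro ⟨y, hy, h⟩
    rwa [hinj ((Nat.prime_dvd_prime_iff_eq (hprime x) (hprime y)).mp h)]
  · exact fun hx => ⟨x, hx, dvd_rfl⟩

theorem squarefree_prod_primes {α : Type*} {p : α → ℕ} (hinj : Function.Injective p)
    (hprime : ∀ x, (p x).Prime) (S : Finset α) : Squarefree (∏ x ∈ S, p x) :=
  Finset.squarefree_prod_of_pairwise_isCoprime
    (fun x _ y _ hxy => Nat.coprime_iff_isRelPrime.mp
      ((Nat.coprime_primes (hprime x) (hprime y)).mpr (hinj.ne hxy)))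
    fun x _ => (hprime x).prime.squarefree

theorem exactCover_circuit_correct {α : Type*} [DecidableEq α]
    (X : Finset α) (k : ℕ) (A : Fin k → Finset α)
    (hnonempty : ∀ j, (A j).Nonempty) (hsub : ∀ j, A j ⊆ X)
    (p : α → ℕ) (hinj : Function.Injective p) (hprime : ∀ x, (p x).Prime)
    (f : Finset α → ℕ) (hf : ∀ S, f S = ∏ x ∈ S, p x)
    (T : ℕ → Set ℕ) (hT0 : T 0 = {f X})
    (hTs : ∀ i : Fin k, T (i + 1) = T i ∪ setDiv (T i) {f (A i)}) :
    1 ∈ T k ↔ ∃ I : Finset (Fin k),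
      (∀ i ∈ I, ∀ j ∈ I, i ≠ j → Disjoint (A i) (A j)) ∧
      I.biUnion A = X := by
  have hf0 : ∀ i, f (A i) ≠ 0 := fun i => by
    rw [hf]
    exact Finset.prod_ne_zero_iff.mpr fun x _ => (hprime x).ne_zero
  have hunion : ∀ I : Finset (Fin k), (∀ i ∈ I, ∀ j ∈ I, i ≠ j → Disjoint (A i) (A j)) →
      ∏ i ∈ I, f (A i) = f (I.biUnion A) := fun I hI => by
    rw [hf, Finset.prod_biUnion hI]
    exact Finset.prod_congr rfl fun i _ => hf (A i)
  rw [mem_iterate_setDiv_iff (fun i => f (A i)) hf0 (f X) T hT0 hTs k le_rfl]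
  refine exists_congr fun I => ?_
  simp only [Fin.is_lt, implies_true, true_and, one_mul]
  constructor
  · intro h
    have hdisj : ∀ i ∈ I, ∀ j ∈ I, i ≠ j → Disjoint (A i) (A j) := by
      intro i hi j hj hij
      refine Finset.disjoint_left.mpr fun x hxi hxj => ?_
      have hdvd : p x * p x ∣ f X := by
        rw [← h, ← Finset.mul_prod_erase I _ hi]
        refine mul_dvd_mul ?_ (dvd_trans ?_ (Finset.dvd_prod_of_mem _
          (Finset.mem_erase.mpr ⟨hij.symm, hj⟩)))
        · exact hf (A i) ▸ Finset.dvd_prod_of_mem p hxi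
        · exact hf (A j) ▸ Finset.dvd_prod_of_mem p hxj
      rw [hf] at hdvd
      exact (hprime x).prime.not_isUnit (squarefree_prod_primes hinj hprime X _ hdvd)
    refine ⟨hdisj, Finset.ext fun x => ?_⟩
    rw [hunion I hdisj, hf, hf] at h
    rw [← prime_dvd_prod_iff_mem hinj hprime, h, prime_dvd_prod_iff_mem hinj hprime]
  · rintro ⟨hdisj, hX⟩
    rw [hunion I hdisj, hX]
end

section
/- Let k ∈ ℕ and q : Fin k → ℕ with q j ≥ 2 for all j and gcd(q i, q j) = 1 for all i ≠ j. For D, E ⊆ (Fin k → ℕ) let σ⁻¹(D) = { ∏_j (q j)^(d j) | d ∈ D } ⊆ ℕ. Then σ⁻¹(D) / σ⁻¹(E) = { ∏_j (q j)^(c j) | ∃ d ∈ D, ∃ e ∈ E, ∀ j, c j + e j = d j }, where / is the element-wise division without remainder on subsets of ℕ. -/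
theorem Nat.exponents_le_of_prod_pow_dvd {ι : Type*} [Fintype ι] {q : ι → ℕ}
    (hq : ∀ j, 2 ≤ q j) (hcop : ∀ i j, i ≠ j → Nat.Coprime (q i) (q j)) {d e : ι → ℕ}
    (h : ∏ j, q j ^ e j ∣ ∏ j, q j ^ d j) : e ≤ d := by
  classical
  intro j
  have hdvd : q j ^ e j ∣ q j ^ d j * ∏ i ∈ Finset.univ.erase j, q i ^ d i := by
    rw [Finset.mul_prod_erase _ (fun i => q i ^ d i) (Finset.mem_univ j)]
    exact (Finset.dvd_prod_of_mem (fun i => q i ^ e i) (Finset.mem_univ j)).trans h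
  have hc : Nat.Coprime (q j ^ e j) (∏ i ∈ Finset.univ.erase j, q i ^ d i) :=
    Nat.Coprime.prod_right fun i hi =>
      Nat.Coprime.pow _ _ (hcop j i (Finset.ne_of_mem_erase hi).symm)
  exact (Nat.pow_dvd_pow_iff_le_right (hq j)).mp (hc.dvd_of_dvd_mul_right hdvd)

theorem gcdFreeBasis_setDiv_eq (k : ℕ) (q : Fin k → ℕ)
    (hq : ∀ j, 2 ≤ q j) (hcop : ∀ i j, i ≠ j → Nat.gcd (q i) (q j) = 1)
    (D E : Set (Fin k → ℕ)) :
    setDiv { n | ∃ d ∈ D, n = ∏ j, (q j) ^ (d j) }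
           { n | ∃ e ∈ E, n = ∏ j, (q j) ^ (e j) } =
      { n | ∃ c : Fin k → ℕ, (∃ d ∈ D, ∃ e ∈ E, ∀ j, c j + e j = d j) ∧
        n = ∏ j, (q j) ^ (c j) } := by
  have hpos (e : Fin k → ℕ) : ∏ j, q j ^ e j ≠ 0 :=
    Finset.prod_ne_zero_iff.mpr fun j _ => pow_ne_zero _ (Nat.ne_zero_of_lt (hq j))
  have hadd {c d e : Fin k → ℕ} (h : ∀ j, c j + e j = d j) :
      ∏ j, q j ^ d j = (∏ j, q j ^ c j) * ∏ j, q j ^ e j := by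
    simp only [← Finset.prod_mul_distrib, ← pow_add, h]
  ext n
  constructor
  · rintro ⟨_, ⟨d, hd, rfl⟩, _, ⟨e, he, rfl⟩, hb, hab⟩
    have hle := Nat.exponents_le_of_prod_pow_dvd hq hcop (Dvd.intro_left n hab.symm)
    have hsub (j : Fin k) : d j - e j + e j = d j := Nat.sub_add_cancel (hle j)
    refine ⟨fun j => d j - e j, ⟨d, hd, e, he, hsub⟩, ?_⟩
    exact mul_right_cancel₀ hb (hab.symm.trans (hadd hsub))
  · rintro ⟨c, ⟨d, hd, e, he, h⟩, rfl⟩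
    exact ⟨_, ⟨d, hd, rfl⟩, _, ⟨e, he, rfl⟩, hpos e, hadd h⟩
end

section
/- Let P be a finite set of primes. Let M = { n ∈ ℕ | n ≥ 1 and every prime factor of n lies in P }, and for each i ∈ ℕ let K_i = { n ∈ ℕ | n ≥ 1, no prime factor of n lies in P, and Ω(n) = i }, where Ω(n) is the number of prime factors of n counted with multiplicity. Let S¹, S² : ℕ → Set ℕ be families with S¹_i ⊆ M and S²_i ⊆ M for all i. Then (⋃_{i ∈ ℕ} S¹_i × K_i) / (⋃_{i ∈ ℕ} S²_i × K_i) = ⋃_{i ∈ ℕ} ( (⋃_{j ≥ i} (S¹_j / S²_{j−i})) × K_i ), where × denotes the element-wise product of subsets of ℕ and / the element-wise division without remainder. -/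
/-- Every positive integer is the product of a part whose prime factors all lie in `P` and a part
none of whose prime factors lie in `P`. -/
theorem exists_smooth_mul_rough (P : Finset ℕ) (c : ℕ) (hc : c ≠ 0) :
    ∃ m k, c = m * k ∧ (∀ p, p.Prime → p ∣ m → p ∈ P) ∧ (∀ p, p.Prime → p ∣ k → p ∉ P) := by
  induction c using induction_on_primes with
  | zero => exact absurd rfl hc
  | one =>
    refine ⟨1, 1, rfl, ?_, ?_⟩ <;>
      exact fun p hp h => absurd (Nat.dvd_one.1 h) hp.ne_one
  | prime_mul q a hq ih =>
    obtain ⟨m, k, rfl, hm, hk⟩ := ih (right_ne_zero_of_mul hc)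
    by_cases hqP : q ∈ P
    · refine ⟨q * m, k, by ring, fun p hp h => ?_, hk⟩
      rcases hp.dvd_mul.1 h with h | h
      · rwa [(Nat.prime_dvd_prime_iff_eq hp hq).1 h]
      · exact hm p hp h
    · refine ⟨m, q * k, by ring, hm, fun p hp h => ?_⟩
      rcases hp.dvd_mul.1 h with h | h
      · rwa [(Nat.prime_dvd_prime_iff_eq hp hq).1 h]
      · exact hk p hp h

theorem coprime_of_smooth_of_rough {P : Finset ℕ} {m k : ℕ}
    (hm : ∀ p, p.Prime → p ∣ m → p ∈ P) (hk : ∀ p, p.Prime → p ∣ k → p ∉ P) :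
    m.Coprime k :=
  Nat.coprime_of_dvd fun p hp hpm hpk => hk p hp hpk (hm p hp hpm)

/-- The smooth part of a positive integer is unique. -/
theorem smooth_part_unique {P : Finset ℕ} {m m' k k' : ℕ}
    (hm : ∀ p, p.Prime → p ∣ m → p ∈ P) (hm' : ∀ p, p.Prime → p ∣ m' → p ∈ P)
    (hk : ∀ p, p.Prime → p ∣ k → p ∉ P) (hk' : ∀ p, p.Prime → p ∣ k' → p ∉ P)
    (h : m * k = m' * k') : m = m' :=
  Nat.dvd_antisymm
    ((coprime_of_smooth_of_rough hm hk').dvd_of_dvd_mul_right (h ▸ Nat.dvd_mul_right m k))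
    ((coprime_of_smooth_of_rough hm' hk).dvd_of_dvd_mul_right (h ▸ Nat.dvd_mul_right m' k'))

theorem forall_prime_dvd_mul {Q : ℕ → Prop} {a b : ℕ} (ha : ∀ p, p.Prime → p ∣ a → Q p)
    (hb : ∀ p, p.Prime → p ∣ b → Q p) : ∀ p, p.Prime → p ∣ a * b → Q p :=
  fun p hp h => (hp.dvd_mul.1 h).elim (ha p hp) (hb p hp)

theorem length_primeFactorsList_mul {a b : ℕ} (ha : a ≠ 0) (hb : b ≠ 0) :
    (a * b).primeFactorsList.length = a.primeFactorsList.length + b.primeFactorsList.length := by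
  rw [(Nat.perm_primeFactorsList_mul ha hb).length_eq, List.length_append]

theorem smooth_rough_division_decomposition (P : Finset ℕ) (hP : ∀ p ∈ P, p.Prime)
    (M : Set ℕ) (hM : M = { n | 1 ≤ n ∧ ∀ p, p.Prime → p ∣ n → p ∈ P })
    (K : ℕ → Set ℕ)
    (hK : ∀ i, K i = { n | 1 ≤ n ∧ (∀ p, p.Prime → p ∣ n → p ∉ P) ∧
      n.primeFactorsList.length = i })
    (S₁ S₂ : ℕ → Set ℕ) (hS₁ : ∀ i, S₁ i ⊆ M) (hS₂ : ∀ i, S₂ i ⊆ M) :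
    setDiv (⋃ i, setMul (S₁ i) (K i)) (⋃ i, setMul (S₂ i) (K i)) =
      ⋃ i, setMul (⋃ j, ⋃ (_ : i ≤ j), setDiv (S₁ j) (S₂ (j - i))) (K i) := by
  subst hM
  obtain rfl : K = _ := funext hK
  ext c
  simp only [setDiv, setMul, Set.mem_iUnion, Set.mem_ofPred_eq]
  constructor
  · rintro ⟨_, ⟨j, s, hs, k₁, ⟨hk₁, hk₁P, hΩ₁⟩, rfl⟩, _, ⟨l, t, ht, k₂, ⟨hk₂, hk₂P, hΩ₂⟩, rfl⟩,
      -, h⟩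
    obtain ⟨hs1, hsP⟩ := hS₁ j hs
    obtain ⟨ht1, htP⟩ := hS₂ l ht
    have hc : c ≠ 0 := by
      rintro rfl
      rw [zero_mul] at h
      exact (Nat.mul_pos hs1 hk₁).ne' h
    obtain ⟨m, k, rfl, hm, hk⟩ := exists_smooth_mul_rough P c hc
    have hk0 : k ≠ 0 := right_ne_zero_of_mul hc
    have h' : s * k₁ = (m * t) * (k * k₂) := by rw [h]; ring
    have hst : s = m * t := smooth_part_unique hsP (forall_prime_dvd_mul hm htP) hk₁P
      (forall_prime_dvd_mul hk hk₂P) h'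
    have hkk : k₁ = k * k₂ := by
      rw [← hst] at h'
      exact Nat.eq_of_mul_eq_mul_left hs1 h'
    have hΩ : j = k.primeFactorsList.length + l := by
      rw [← hΩ₁, ← hΩ₂, hkk, length_primeFactorsList_mul hk0 (by omega)]
    refine ⟨k.primeFactorsList.length, m, ⟨j, by omega, s, hs, t, ?_, by omega, hst⟩, k,
      ⟨Nat.pos_of_ne_zero hk0, hk, rfl⟩, rfl⟩
    rwa [hΩ, Nat.add_sub_cancel_left]
  · rintro ⟨i, m, ⟨j, hij, s, hs, t, ht, ht0, hst⟩, k, ⟨hk1, hkP, hΩ⟩, rfl⟩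
    obtain ⟨q, hqP, hq⟩ : ∃ q, q ∉ P ∧ q.Prime := by
      obtain ⟨q, hq, hqP⟩ := Nat.infinite_setOfPred_prime.exists_notMem_finset P
      exact ⟨q, hqP, hq⟩
    have hr0 : q ^ (j - i) ≠ 0 := pow_ne_zero _ hq.ne_zero
    have hrP : ∀ p, p.Prime → p ∣ q ^ (j - i) → p ∉ P := fun p hp h => by
      rwa [(Nat.prime_dvd_prime_iff_eq hp hq).1 (hp.dvd_of_dvd_pow h)]
    have hrΩ : (q ^ (j - i)).primeFactorsList.length = j - i := by
      rw [hq.primeFactorsList_pow, List.length_replicate]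
    refine ⟨s * (k * q ^ (j - i)), ⟨j, s, hs, _, ⟨?_, forall_prime_dvd_mul hkP hrP, ?_⟩, rfl⟩,
      t * q ^ (j - i), ⟨j - i, t, ht, _, ⟨Nat.pos_of_ne_zero hr0, hrP, hrΩ⟩, rfl⟩,
      mul_ne_zero ht0 hr0, by rw [hst]; ring⟩
    · exact Nat.mul_pos hk1 (Nat.pos_of_ne_zero hr0)
    · rw [length_primeFactorsList_mul (by omega) hr0, hrΩ, hΩ]
      omega
end
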